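/- Let Δt > 0 and let x^m_h, x^{m+1/2}_h, z^{m+1/2}_h ∈ V^h be given. Then any pair (x^{m+1}_h, y^{m+1/2}_h) ∈ V^h × V^h satisfying the curve diffusion corrector equations [for all χ ∈ V^h: ∫₀¹ ((x^{m+1}_h − x^m_h)/Δt)·χ |x^{m+1/2}_{h,ρ}|² dρ − ∫₀¹ y^{m+1/2}_{h,ρ}·χ_ρ dρ = 2∫₀¹ (y^{m+1/2}_{h,ρ}·x^{m+1/2}_{h,ρ})(z^{m+1/2}_h·χ) dρ + ∫₀¹ (z^{m+1/2}_h·y^{m+1/2}_h)(z^{m+1/2}_h·χ) |x^{m+1/2}_{h,ρ}|² dρ + ∫₀¹ (F₂(x^{m+1/2}_{h,ρ}, z^{m+1/2}_h, z^{m+1/2}_{h,ρ}) y^{m+1/2}_h)·χ dρ; and for all η ∈ V^h: ∫₀¹ y^{m+1/2}_h·η |x^{m+1/2}_{h,ρ}|² dρ + ½∫₀¹ x^{m+1}_{h,ρ}·η_ρ dρ = −½∫₀¹ x^m_{h,ρ}·η_ρ dρ] satisfies the exact stability identity ½∫₀¹ |x^{m+1}_{h,ρ}|² dρ + Δt ∫₀¹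 | y^{m+1/2}_{h,ρ} + (z^{m+1/2}_h·y^{m+1/2}_h) x^{m+1/2}_{h,ρ} |² dρ = ½∫₀¹ |x^m_{h,ρ}|² dρ. In particular the discrete Dirichlet energy is non-increasing. -/

import Mathlib

open scoped BigOperators RealInnerProductSpace

noncomputable section

/-- The space `V^h` of continuous, 1-periodic, piecewise affine (with respect to the
partition `ρ`) vector-valued finite element functions. -/
def Vh (d J : ℕ) (ρ : ℤ → ℝ) : Set (ℝ → EuclideanSpace ℝ (Fin d)) :=
  {u | Continuous u ∧ (∀ θ : ℝ, u (θ + 1) = u θ) ∧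
    ∀ j : ℤ, ∃ a b : EuclideanSpace ℝ (Fin d),
      ∀ θ ∈ Set.Icc (ρ (j - 1)) (ρ j), u θ = a + θ • b}

/-- `F₂(a,b,c)w` where `F₂(a,b,c) = 2(c⊗a − a⊗c) + 2(a·b)(a⊗b − b⊗a)` and
`(u⊗v)w = (v·w)u`. -/
def F2app {d : ℕ} (a b c w : EuclideanSpace ℝ (Fin d)) : EuclideanSpace ℝ (Fin d) :=
  (2 : ℝ) • (⟪a, w⟫ • c - ⟪c, w⟫ • a) + (2 * ⟪a, b⟫) • (⟪b, w⟫ • a - ⟪a, w⟫ • b)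

open MeasureTheory Set

/-- Finite element functions are closed under subtraction. -/
lemma Vh.sub_mem {d J : ℕ} {ρ : ℤ → ℝ} {u v : ℝ → EuclideanSpace ℝ (Fin d)}
    (hu : u ∈ Vh d J ρ) (hv : v ∈ Vh d J ρ) : (fun θ => u θ - v θ) ∈ Vh d J ρ := by
  obtain ⟨huc, hup, hua⟩ := hu
  obtain ⟨hvc, hvp, hva⟩ := hv
  refine ⟨huc.sub hvc, fun θ => by simp only [hup, hvp], fun j => ?_⟩
  obtain ⟨a, b, hab⟩ := hua j
  obtain ⟨a', b', hab'⟩ := hva j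
  refine ⟨a - a', b - b', fun θ hθ => ?_⟩
  simp only [hab θ hθ, hab' θ hθ, smul_sub]
  abel

/-- On each open mesh interval a finite element function has a constant derivative. -/
lemma Vh.exists_hasDerivAt {d J : ℕ} {ρ : ℤ → ℝ} {u : ℝ → EuclideanSpace ℝ (Fin d)}
    (hu : u ∈ Vh d J ρ) (j : ℤ) :
    ∃ b, ∀ θ ∈ Ioo (ρ (j - 1)) (ρ j), HasDerivAt u b θ := by
  obtain ⟨a, b, hab⟩ := hu.2.2 j
  refine ⟨b, fun θ hθ => ?_⟩
  have h : HasDerivAt (fun t : ℝ => a + t • b) b θ := by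
    simpa using ((hasDerivAt_id θ).smul_const b).const_add a
  refine h.congr_of_eventuallyEq ?_
  filter_upwards [Ioo_mem_nhds hθ.1 hθ.2] with t ht
  exact hab t (Ioo_subset_Icc_self ht)

lemma Icc_subset_Icc_union_Ioo_union_singleton (a b c : ℝ) :
    Icc a c ⊆ Icc a b ∪ Ioo b c ∪ {c} := by
  intro θ hθ
  rcases le_or_gt θ b with h | h
  · exact Or.inl (Or.inl ⟨hθ.1, h⟩)
  · rcases hθ.2.lt_or_eq with h' | h'
    · exact Or.inl (Or.inr ⟨h, h'⟩)
    · exact Or.inr h'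

lemma Vh.isBounded_deriv_image {d J : ℕ} {ρ : ℤ → ℝ} {u : ℝ → EuclideanSpace ℝ (Fin d)}
    (hu : u ∈ Vh d J ρ) (n : ℕ) :
    Bornology.IsBounded (deriv u '' Icc (ρ 0) (ρ n)) := by
  induction n with
  | zero => simp
  | succ n ih =>
    obtain ⟨b, hb⟩ := Vh.exists_hasDerivAt hu ((n + 1 : ℕ) : ℤ)
    have hbd : Bornology.IsBounded (deriv u '' Ioo (ρ n) (ρ (n + 1 : ℕ))) := by
      refine (Bornology.isBounded_singleton (x := b)).subset ?_
      rintro _ ⟨θ, hθ, rfl⟩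
      exact (hb θ (by simpa using hθ)).deriv
    refine ((ih.union hbd).union (Bornology.isBounded_singleton
      (x := deriv u (ρ (n + 1 : ℕ))))).subset ?_
    rw [← image_singleton, ← image_union, ← image_union]
    exact image_mono (Icc_subset_Icc_union_Ioo_union_singleton _ _ _)

lemma Vh.countable_not_differentiableAt {d J : ℕ} {ρ : ℤ → ℝ}
    {u : ℝ → EuclideanSpace ℝ (Fin d)} (hu : u ∈ Vh d J ρ) (n : ℕ) :
    (Icc (ρ 0) (ρ n) ∩ {θ | ¬ DifferentiableAt ℝ u θ}).Countable := by
  induction n with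
  | zero => exact (countable_singleton (ρ 0)).mono (by simp)
  | succ n ih =>
    obtain ⟨b, hb⟩ := Vh.exists_hasDerivAt hu ((n + 1 : ℕ) : ℤ)
    refine (ih.union (countable_singleton (ρ (n + 1 : ℕ)))).mono ?_
    rintro θ ⟨hθ, hd⟩
    rcases Icc_subset_Icc_union_Ioo_union_singleton _ (ρ n) _ hθ with (h | h) | h
    · exact Or.inl ⟨h, hd⟩
    · exact absurd (hb θ (by simpa using h)).differentiableAt hd
    · exact Or.inr h

lemma Vh.memLp_deriv {d J : ℕ} {ρ : ℤ → ℝ} {u : ℝ → EuclideanSpace ℝ (Fin d)}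
    (hu : u ∈ Vh d J ρ) (h0 : ρ 0 = 0) (h1 : ρ J = 1) :
    MemLp (deriv u) ⊤ (volume.restrict (Ioc (0 : ℝ) 1)) := by
  obtain ⟨C, hC⟩ := (Vh.isBounded_deriv_image hu J).exists_norm_le
  refine memLp_top_of_bound (measurable_deriv u).aestronglyMeasurable C ?_
  filter_upwards [ae_restrict_mem measurableSet_Ioc] with θ hθ
  refine hC _ (mem_image_of_mem _ ?_)
  rw [h0, h1]
  exact Ioc_subset_Icc_self hθ

lemma Vh.ae_differentiableAt {d J : ℕ} {ρ : ℤ → ℝ} {u : ℝ → EuclideanSpace ℝ (Fin d)}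
    (hu : u ∈ Vh d J ρ) (h0 : ρ 0 = 0) (h1 : ρ J = 1) :
    ∀ᵐ θ : ℝ, θ ∈ Ioc (0 : ℝ) 1 → DifferentiableAt ℝ u θ := by
  filter_upwards [(Vh.countable_not_differentiableAt hu J).ae_notMem volume] with θ hθ hI
  by_contra hd
  exact hθ ⟨by rw [h0, h1]; exact Ioc_subset_Icc_self hI, hd⟩

lemma Continuous.memLp_top_restrict_Ioc {E : Type*} [NormedAddCommGroup E]
    [SecondCountableTopology E] {u : ℝ → E} (hu : Continuous u) (a b : ℝ) :
    MemLp u ⊤ (volume.restrict (Ioc a b)) := by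
  obtain ⟨C, hC⟩ := (isCompact_Icc (a := a) (b := b)).exists_bound_of_continuousOn
    hu.continuousOn
  refine memLp_top_of_bound hu.aestronglyMeasurable C ?_
  filter_upwards [ae_restrict_mem measurableSet_Ioc] with θ hθ
  exact hC θ (Ioc_subset_Icc_self hθ)

lemma MeasureTheory.MemLp.inner_top {E α : Type*} [NormedAddCommGroup E]
    [InnerProductSpace ℝ E] [MeasurableSpace α] {μ : Measure α} {f g : α → E}
    (hf : MemLp f ⊤ μ) (hg : MemLp g ⊤ μ) : MemLp (fun x => ⟪f x, g x⟫) ⊤ μ :=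
  (innerSL ℝ).memLp_of_bilin ⊤ hf hg

lemma MeasureTheory.MemLp.intervalIntegrable_of_top {f : ℝ → ℝ}
    (hf : MemLp f ⊤ (volume.restrict (Ioc (0 : ℝ) 1))) :
    IntervalIntegrable f volume 0 1 :=
  (intervalIntegrable_iff_integrableOn_Ioc_of_le zero_le_one).2 (hf.integrable le_top)

/-- Anti-symmetry of `F₂(a,b,c)`. -/
lemma inner_F2app_self {d : ℕ} (a b c w : EuclideanSpace ℝ (Fin d)) :
    ⟪F2app a b c w, w⟫ = 0 := by
  simp only [F2app, inner_add_left, inner_sub_left, real_inner_smul_left]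
  ring

/-- Stability of the Crank–Nicolson-type corrector step of the second order finite
element scheme for curve diffusion: any solution `(x^{m+1}_h, y^{m+1/2}_h)` of the
corrector equations satisfies the exact energy identity
`½∫|x^{m+1}_{h,ρ}|² + Δt∫|y^{m+1/2}_{h,ρ} + (z^{m+1/2}_h·y^{m+1/2}_h)x^{m+1/2}_{h,ρ}|²
 = ½∫|x^m_{h,ρ}|²`; in particular the discrete Dirichlet energy is non-increasing. -/
theorem cd_corrector_stability
    (d : ℕ) (hd : 2 ≤ d) (J : ℕ) (hJ : 3 ≤ J)
    (ρ : ℤ → ℝ) (hmono : StrictMono ρ) (hρ0 : ρ 0 = 0)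
    (hρper : ∀ j : ℤ, ρ (j + (J : ℤ)) = ρ j + 1)
    (Δt : ℝ) (hΔt : 0 < Δt)
    (xm xh zh : ℝ → EuclideanSpace ℝ (Fin d))
    (hxm : xm ∈ Vh d J ρ) (hxh : xh ∈ Vh d J ρ) (hzh : zh ∈ Vh d J ρ)
    (xp yh : ℝ → EuclideanSpace ℝ (Fin d))
    (hxp : xp ∈ Vh d J ρ) (hyh : yh ∈ Vh d J ρ)
    (heq1 : ∀ χ ∈ Vh d J ρ,
      (∫ θ in (0 : ℝ)..1, ⟪Δt⁻¹ • (xp θ - xm θ), χ θ⟫ * ‖deriv xh θ‖ ^ 2)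
          - ∫ θ in (0 : ℝ)..1, ⟪deriv yh θ, deriv χ θ⟫
        = 2 * (∫ θ in (0 : ℝ)..1, ⟪deriv yh θ, deriv xh θ⟫ * ⟪zh θ, χ θ⟫)
          + (∫ θ in (0 : ℝ)..1, ⟪zh θ, yh θ⟫ * ⟪zh θ, χ θ⟫ * ‖deriv xh θ‖ ^ 2)
          + ∫ θ in (0 : ℝ)..1, ⟪F2app (deriv xh θ) (zh θ) (deriv zh θ) (yh θ), χ θ⟫)
    (heq2 : ∀ η ∈ Vh d J ρ,
      (∫ θ in (0 : ℝ)..1, ⟪yh θ, η θ⟫ * ‖deriv xh θ‖ ^ 2)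
          + (1 / 2) * ∫ θ in (0 : ℝ)..1, ⟪deriv xp θ, deriv η θ⟫
        = -((1 / 2) * ∫ θ in (0 : ℝ)..1, ⟪deriv xm θ, deriv η θ⟫)) :
    ((1 / 2) * (∫ θ in (0 : ℝ)..1, ‖deriv xp θ‖ ^ 2)
        + Δt * ∫ θ in (0 : ℝ)..1, ‖deriv yh θ + ⟪zh θ, yh θ⟫ • deriv xh θ‖ ^ 2
      = (1 / 2) * ∫ θ in (0 : ℝ)..1, ‖deriv xm θ‖ ^ 2)
    ∧ (1 / 2) * (∫ θ in (0 : ℝ)..1, ‖deriv xp θ‖ ^ 2)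
        ≤ (1 / 2) * ∫ θ in (0 : ℝ)..1, ‖deriv xm θ‖ ^ 2 := by
  have hρ1 : ρ J = 1 := by simpa [hρ0] using hρper 0
  have dxp := Vh.memLp_deriv hxp hρ0 hρ1
  have dxm := Vh.memLp_deriv hxm hρ0 hρ1
  have dxh := Vh.memLp_deriv hxh hρ0 hρ1
  have dyh := Vh.memLp_deriv hyh hρ0 hρ1
  have hzy : MemLp (fun θ => ⟪zh θ, yh θ⟫) ⊤ (volume.restrict (Ioc (0 : ℝ) 1)) :=
    (hzh.1.memLp_top_restrict_Ioc 0 1).inner_top (hyh.1.memLp_top_restrict_Ioc 0 1)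
  have hderiv : ∀ᵐ θ : ℝ, θ ∈ uIoc (0 : ℝ) 1 →
      deriv (fun t => xp t - xm t) θ = deriv xp θ - deriv xm θ := by
    rw [uIoc_of_le zero_le_one]
    filter_upwards [Vh.ae_differentiableAt hxp hρ0 hρ1,
      Vh.ae_differentiableAt hxm hρ0 hρ1] with θ hp hm hI
    exact deriv_fun_sub (hp hI) (hm hI)
  have htest : ∀ w : ℝ → EuclideanSpace ℝ (Fin d),
      MemLp w ⊤ (volume.restrict (Ioc (0 : ℝ) 1)) →
      ∫ θ in (0 : ℝ)..1, ⟪w θ, deriv (fun t => xp t - xm t) θ⟫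
        = (∫ θ in (0 : ℝ)..1, ⟪w θ, deriv xp θ⟫) - ∫ θ in (0 : ℝ)..1, ⟪w θ, deriv xm θ⟫ := by
    intro w hw
    rw [← intervalIntegral.integral_sub (hw.inner_top dxp).intervalIntegrable_of_top
      (hw.inner_top dxm).intervalIntegrable_of_top]
    refine intervalIntegral.integral_congr_ae ?_
    filter_upwards [hderiv] with θ hθ hI
    rw [hθ hI, inner_sub_right]
  have hdissipation : ∫ θ in (0 : ℝ)..1, ‖deriv yh θ + ⟪zh θ, yh θ⟫ • deriv xh θ‖ ^ 2
      = (∫ θ in (0 : ℝ)..1, ⟪deriv yh θ, deriv yh θ⟫)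
        + 2 * (∫ θ in (0 : ℝ)..1, ⟪deriv yh θ, deriv xh θ⟫ * ⟪zh θ, yh θ⟫)
        + ∫ θ in (0 : ℝ)..1, ⟪zh θ, yh θ⟫ * ⟪zh θ, yh θ⟫ * ‖deriv xh θ‖ ^ 2 := by
    have i1 := (dyh.inner_top dyh).intervalIntegrable_of_top
    have i2 : IntervalIntegrable (fun θ => ⟪deriv yh θ, deriv xh θ⟫ * ⟪zh θ, yh θ⟫)
        volume 0 1 :=
      (hzy.mul (dyh.inner_top dxh)).intervalIntegrable_of_top
    have i3 : IntervalIntegrable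
        (fun θ => ⟪zh θ, yh θ⟫ * ⟪zh θ, yh θ⟫ * ‖deriv xh θ‖ ^ 2) volume 0 1 := by
      simp only [← real_inner_self_eq_norm_sq]
      exact ((dxh.inner_top dxh).mul (hzy.mul hzy (r := ⊤)) (r := ⊤)).intervalIntegrable_of_top
    rw [← intervalIntegral.integral_const_mul,
      ← intervalIntegral.integral_add i1 (i2.const_mul 2),
      ← intervalIntegral.integral_add (i1.add (i2.const_mul 2)) i3]
    refine intervalIntegral.integral_congr fun θ _ => ?_
    simp only [norm_add_sq_real, norm_smul, real_inner_smul_right, mul_pow,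
      Real.norm_eq_abs, sq_abs, real_inner_self_eq_norm_sq]
    ring
  have h1 := heq1 yh hyh
  have h2 := heq2 _ (Vh.sub_mem hxp hxm)
  have hcomm : ∫ θ in (0 : ℝ)..1, ⟪deriv xm θ, deriv xp θ⟫
      = ∫ θ in (0 : ℝ)..1, ⟪deriv xp θ, deriv xm θ⟫ := by
    simp only [real_inner_comm]
  have hscale : ∫ θ in (0 : ℝ)..1, ⟪Δt⁻¹ • (xp θ - xm θ), yh θ⟫ * ‖deriv xh θ‖ ^ 2
      = Δt⁻¹ * ∫ θ in (0 : ℝ)..1, ⟪yh θ, xp θ - xm θ⟫ * ‖deriv xh θ‖ ^ 2 := by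
    rw [← intervalIntegral.integral_const_mul]
    refine intervalIntegral.integral_congr fun θ _ => ?_
    simp only [real_inner_comm (yh θ), real_inner_smul_right, mul_assoc]
  simp only [inner_F2app_self, intervalIntegral.integral_zero, add_zero, hscale] at h1
  rw [htest _ dxp, htest _ dxm, hcomm] at h2
  simp only [real_inner_self_eq_norm_sq] at h1 h2 hdissipation
  have hbalance : Δt * ∫ θ in (0 : ℝ)..1, ‖deriv yh θ + ⟪zh θ, yh θ⟫ • deriv xh θ‖ ^ 2
      = ∫ θ in (0 : ℝ)..1, ⟪yh θ, xp θ - xm θ⟫ * ‖deriv xh θ‖ ^ 2 := by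
    rw [eq_comm, ← inv_mul_eq_iff_eq_mul₀ hΔt.ne', hdissipation]
    linarith
  have hnonneg :
      0 ≤ Δt * ∫ θ in (0 : ℝ)..1, ‖deriv yh θ + ⟪zh θ, yh θ⟫ • deriv xh θ‖ ^ 2 :=
    mul_nonneg hΔt.le (intervalIntegral.integral_nonneg zero_le_one fun θ _ => by positivity)
  constructor <;> linarith
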